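/- Let L be a complete Boolean algebra, let E be a bounded right-continuous spectral family in L, and let 𝔅 be a quasipoint of L. Then sSup {λ ∈ ℝ | (E_λ)ᶜ ∈ 𝔅} = sInf {λ ∈ ℝ | E_λ ∈ 𝔅}; that is, the antonymous function of the complement family λ ↦ (E_λ)ᶜ coincides with the observable function of E. -/

import Mathlib

/-- A dual ideal in a complete Boolean algebra. -/
def IsDualIdeal {L : Type*} [CompleteBooleanAlgebra L] (D : Set L) : Prop :=
  D.Nonempty ∧ ⊥ ∉ D ∧ (∀ a ∈ D, ∀ b ∈ D, a ⊓ b ∈ D) ∧ ∀ a ∈ D, ∀ b : L, a ≤ b → b ∈ D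

/-- A quasipoint: a maximal dual ideal. -/
def IsQuasipoint {L : Type*} [CompleteBooleanAlgebra L] (D : Set L) : Prop :=
  IsDualIdeal D ∧ ∀ D' : Set L, IsDualIdeal D' → D ⊆ D' → D' = D

/-- A bounded right-continuous spectral family in a complete Boolean algebra. -/
def IsBoundedRightContinuousSpectralFamily {L : Type*} [CompleteBooleanAlgebra L]
    (E : ℝ → L) : Prop :=
  Monotone E ∧ (∀ l : ℝ, E l = ⨅ μ, ⨅ _ : l < μ, E μ) ∧
    ∃ a b : ℝ, a ≤ b ∧ (∀ l : ℝ, l < a → E l = ⊥) ∧ ∀ l : ℝ, b < l → E l = ⊤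

/-- A quasipoint contains each element or its complement. -/
theorem IsQuasipoint.mem_or_compl_mem {L : Type*} [CompleteBooleanAlgebra L] {B : Set L}
    (hB : IsQuasipoint B) (a : L) : a ∈ B ∨ aᶜ ∈ B := by
  obtain ⟨⟨⟨c, hc⟩, -, hinf, hup⟩, hmax⟩ := hB
  by_cases h : ∃ b ∈ B, b ⊓ a ≤ ⊥
  · obtain ⟨b, hb, hba⟩ := h
    exact Or.inr (hup b hb _ (le_compl_iff_disjoint_right.2 (disjoint_iff_inf_le.2 hba)))
  · left
    have hD : IsDualIdeal {x | ∃ b ∈ B, b ⊓ a ≤ x} := by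
      refine ⟨⟨a, c, hc, inf_le_right⟩, h, ?_, ?_⟩
      · rintro x ⟨b, hb, hbx⟩ y ⟨d, hd, hdy⟩
        exact ⟨b ⊓ d, hinf b hb d hd, le_inf
          ((inf_le_inf_right a inf_le_left).trans hbx)
          ((inf_le_inf_right a inf_le_right).trans hdy)⟩
      · rintro x ⟨b, hb, hbx⟩ y hxy
        exact ⟨b, hb, hbx.trans hxy⟩
    rw [← hmax _ hD fun b hb => ⟨b, hb, inf_le_left⟩]
    exact ⟨c, hc, inf_le_right⟩

/-- A dual ideal does not contain both an element and its complement. -/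
theorem IsDualIdeal.compl_notMem {L : Type*} [CompleteBooleanAlgebra L] {D : Set L}
    (hD : IsDualIdeal D) {a : L} (ha : a ∈ D) : aᶜ ∉ D := fun hac =>
  hD.2.1 (inf_compl_eq_bot (a := a) ▸ hD.2.2.1 a ha _ hac)

/-- A dual ideal contains the top element. -/
theorem IsDualIdeal.top_mem {L : Type*} [CompleteBooleanAlgebra L] {D : Set L}
    (hD : IsDualIdeal D) : ⊤ ∈ D :=
  hD.1.elim fun a ha => hD.2.2.2 a ha _ le_top

/-- In a complete Boolean algebra (e.g. the projection lattice of an abelian von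
Neumann algebra), the antonymous function of the complement family `λ ↦ (E_λ)ᶜ`
coincides with the observable function of `E` on every quasipoint. -/
theorem antonymous_stmt11 {L : Type*} [CompleteBooleanAlgebra L]
    (E : ℝ → L) (hE : IsBoundedRightContinuousSpectralFamily E)
    (B : Set L) (hB : IsQuasipoint B) :
    sSup {l : ℝ | (E l)ᶜ ∈ B} = sInf {l : ℝ | E l ∈ B} := by
  have hD : IsDualIdeal B := hB.1
  obtain ⟨hmono, -, a, b, -, hbot, htop⟩ := hE
  have hT : (b + 1) ∈ {l : ℝ | E l ∈ B} := by
    simpa [htop (b + 1) (by linarith)] using hD.top_mem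
  have hS : (a - 1) ∈ {l : ℝ | (E l)ᶜ ∈ B} := by
    simpa [hbot (a - 1) (by linarith)] using hD.top_mem
  have hlt : ∀ s ∈ {l : ℝ | (E l)ᶜ ∈ B}, ∀ t ∈ {l : ℝ | E l ∈ B}, s ≤ t := by
    intro s hs t ht
    by_contra! hts
    exact hD.compl_notMem (hD.2.2.2 _ ht _ (hmono hts.le)) hs
  refine le_antisymm (csSup_le ⟨_, hS⟩ fun s hs => le_csInf ⟨_, hT⟩ (hlt s hs)) ?_
  by_contra! h
  obtain ⟨m, hSm, hmT⟩ := exists_between h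
  rcases hB.mem_or_compl_mem (E m) with hm | hm
  · exact hmT.not_ge (csInf_le ⟨_, hlt _ hS⟩ hm)
  · exact hSm.not_ge (le_csSup ⟨_, fun s hs => hlt s hs _ hT⟩ hm)
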